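/- Let n+s be odd with 0 ≤ s ≤ n−5 and f ∈ WRP with sign ε and dual g, and consider the code C_{D_{f,sq}} with defining set D_{f,sq} = {x ∈ F_q : f(x) ∈ SQ}. If ε η_0(−1)^{(n+s−1)/2} = 1, then C_{D_{f,sq}} is a minimal linear code with parameters [((p−1)/2)(p^{n−1} + p^{(n+s−1)/2}), n, ((p−1)²/2)p^{n−2}]_p; otherwise C_{D_{f,sq}} is a minimal linear code with parameters [((p−1)/2)(p^{n−1} − p^{(n+s−1)/2}), n, ((p−1)/2)((p−1)p^{n−2} − (p+1)p^{(n+s−3)/2})]_p. -/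

import Mathlib

open scoped BigOperators Classical

noncomputable section

/-- `ξ_p^j` for `j : ZMod p`, where `ξ_p = exp(2πi/p)` and the exponent `j`
is lifted to a natural number. -/
def ep (p : ℕ) (j : ZMod p) : ℂ :=
  Complex.exp (2 * Real.pi * Complex.I * (j.val : ℂ) / (p : ℂ))

/-- `√(p*)`: equal to `√p` if `p ≡ 1 (mod 4)` and to `i√p` if `p ≡ 3 (mod 4)`. -/
def sqrtPStar (p : ℕ) : ℂ :=
  if p % 4 = 1 then ((Real.sqrt p : ℝ) : ℂ) else Complex.I * ((Real.sqrt p : ℝ) : ℂ)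

/-- The quadratic character `η₀` of `F_p` (extended by `η₀(0) = 0`), with values in `ℂ`. -/
def eta0 (p : ℕ) [Fact p.Prime] (j : ZMod p) : ℂ :=
  ((quadraticChar (ZMod p) j : ℤ) : ℂ)

/-- The Walsh transform of `f : F_q → F_p`. -/
def walsh (p : ℕ) {F : Type*} [Field F] [Fintype F] [Algebra (ZMod p) F]
    (f : F → ZMod p) (β : F) : ℂ :=
  ∑ x : F, ep p (f x - Algebra.trace (ZMod p) F (β * x))

/-- `f` is weakly regular `s`-plateaued with sign `ε` and dual `g`:
`W_f(β) = ε √(p*)^{n+s} ξ_p^{g(β)}` on the Walsh support, `W_f(β) = 0` off it,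
and `g` vanishes off the Walsh support. -/
def IsWeaklyRegularPlateaued (p n s : ℕ) {F : Type*} [Field F] [Fintype F]
    [Algebra (ZMod p) F] (f : F → ZMod p) (ε : ℂ) (g : F → ZMod p) : Prop :=
  (ε = 1 ∨ ε = -1) ∧
  (∀ β : F, walsh p f β ≠ 0 →
      walsh p f β = ε * sqrtPStar p ^ (n + s) * ep p (g β)) ∧
  (∀ β : F, walsh p f β = 0 → g β = 0)

/-- `f` lies in the class `WRP`: weakly regular `s`-plateaued with sign `ε` and dual `g`,
unbalanced, `f(0) = 0`, and `f(ax) = a^h f(x)` for some positive even `h` with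
`gcd(h-1, p-1) = 1`. -/
def IsWRP (p n s : ℕ) {F : Type*} [Field F] [Fintype F]
    [Algebra (ZMod p) F] (f : F → ZMod p) (ε : ℂ) (g : F → ZMod p) : Prop :=
  IsWeaklyRegularPlateaued p n s f ε g ∧
  walsh p f 0 ≠ 0 ∧
  f 0 = 0 ∧
  ∃ h : ℕ, 0 < h ∧ Even h ∧ Nat.gcd (h - 1) (p - 1) = 1 ∧
    ∀ (a : (ZMod p)ˣ) (x : F),
      f (algebraMap (ZMod p) F (a : ZMod p) * x) = (a : ZMod p) ^ h * f x

/-- The defining set `D_f = {x ∈ F_q^* : f(x) = 0}`. -/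
def Dzero (p : ℕ) {F : Type*} [Field F] [Fintype F] [Algebra (ZMod p) F]
    (f : F → ZMod p) : Finset F :=
  Finset.univ.filter fun x => x ≠ 0 ∧ f x = 0

/-- The defining set `D_{f,sq} = {x ∈ F_q : f(x) ∈ SQ}`. -/
def Dsq (p : ℕ) {F : Type*} [Field F] [Fintype F] [Algebra (ZMod p) F]
    (f : F → ZMod p) : Finset F :=
  Finset.univ.filter fun x => f x ≠ 0 ∧ IsSquare (f x)

/-- The defining set `D_{f,nsq} = {x ∈ F_q : f(x) ∈ NSQ}`. -/
def Dnsq (p : ℕ) {F : Type*} [Field F] [Fintype F] [Algebra (ZMod p) F]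
    (f : F → ZMod p) : Finset F :=
  Finset.univ.filter fun x => f x ≠ 0 ∧ ¬ IsSquare (f x)

/-- The codeword `c_β = (Tr(βd))_{d ∈ D}` of the code `C_D`. -/
def cword (p : ℕ) {F : Type*} [Field F] [Fintype F] [Algebra (ZMod p) F]
    (D : Finset F) (β : F) : D → ZMod p :=
  fun d => Algebra.trace (ZMod p) F (β * (d : F))

/-- The Hamming weight of the codeword `c_β` of the code `C_D`. -/
def wtOn (p : ℕ) {F : Type*} [Field F] [Fintype F] [Algebra (ZMod p) F]
    (D : Finset F) (β : F) : ℕ :=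
  (D.filter fun d => Algebra.trace (ZMod p) F (β * d) ≠ 0).card

/-- `u` covers `v` : the support of `v` is contained in the support of `u`. -/
def Covers {k : ℕ} {ι : Type*} (u v : ι → ZMod k) : Prop :=
  ∀ i, v i ≠ 0 → u i ≠ 0

/-- The code `C_D` is minimal: every nonzero codeword covers only its own
nonzero scalar multiples among the nonzero codewords. -/
def IsMinimalCode (p : ℕ) {F : Type*} [Field F] [Fintype F] [Algebra (ZMod p) F]
    (D : Finset F) : Prop :=
  ∀ β : F, cword p D β ≠ 0 →
    ∀ β' : F, cword p D β' ≠ 0 → Covers (cword p D β) (cword p D β') →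
      ∃ a : ZMod p, a ≠ 0 ∧ cword p D β' = a • cword p D β

/-- The code `C_D` is an `[m, n, d]_p` code: length `m`, dimension `n`
(i.e. `β ↦ c_β` is injective, so the code has `p^n` codewords), and minimum
nonzero Hamming weight `d`. -/
def HasParams (p : ℕ) {F : Type*} [Field F] [Fintype F] [Algebra (ZMod p) F]
    (D : Finset F) (m d : ℤ) : Prop :=
  (D.card : ℤ) = m ∧
  Function.Injective (cword p D) ∧
  (∀ β : F, cword p D β ≠ 0 → d ≤ (wtOn p D β : ℤ)) ∧
  (∃ β : F, cword p D β ≠ 0 ∧ (wtOn p D β : ℤ) = d)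

lemma ep_eq_stdAddChar (p : ℕ) [Fact p.Prime] (j : ZMod p) : ep p j = ZMod.stdAddChar j := by
  rw [ZMod.stdAddChar_apply, ZMod.toCircle_apply, ep]

lemma isPrimitiveRoot_ep_one (p : ℕ) [Fact p.Prime] : IsPrimitiveRoot (ep p 1) p := by
  have hp := (Fact.out : p.Prime)
  have h := Complex.isPrimitiveRoot_exp p hp.ne_zero
  have : Fact (1 < p) := ⟨hp.one_lt⟩
  rw [ep, ZMod.val_one]
  simpa using h

lemma cyclotomic_dvd_of_aeval_ep (p : ℕ) [Fact p.Prime] {P : Polynomial ℤ}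
    (h : Polynomial.aeval (ep p 1) P = 0) : Polynomial.cyclotomic p ℤ ∣ P := by
  have hp := (Fact.out : p.Prime)
  rw [Polynomial.cyclotomic_eq_minpoly (isPrimitiveRoot_ep_one p) hp.pos]
  exact minpoly.isIntegrallyClosed_dvd ((isPrimitiveRoot_ep_one p).isIntegral hp.pos) h

lemma sum_zmod_eq_sum_range {M : Type*} [AddCommMonoid M] (p : ℕ) [NeZero p] (a : ZMod p → M) :
    ∑ j, a j = ∑ k ∈ Finset.range p, a (k : ZMod p) := by
  refine Finset.sum_bij' (fun j _ => j.val) (fun k _ => (k : ZMod p)) ?_ ?_ ?_ ?_ ?_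
  · intro j _; exact Finset.mem_range.2 (ZMod.val_lt j)
  · simp
  · simp
  · intro k hk; exact ZMod.val_cast_of_lt (Finset.mem_range.1 hk)
  · simp

lemma ep_natCast (p : ℕ) [Fact p.Prime] (k : ℕ) : ep p (k : ZMod p) = ep p 1 ^ k := by
  rw [ep_eq_stdAddChar, ep_eq_stdAddChar, ← AddChar.map_nsmul_eq_pow]
  simp

/-- Integer relations among the `p`-th roots of unity have constant coefficients. -/
lemma eq_of_sum_mul_ep_eq_zero (p : ℕ) [Fact p.Prime] (a : ZMod p → ℤ)
    (h : ∑ j, (a j : ℂ) * ep p j = 0) (i : ZMod p) : a i = a (-1) := by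
  have hp := (Fact.out : p.Prime)
  set P : Polynomial ℤ :=
    ∑ k ∈ Finset.range p, Polynomial.C (a (k : ZMod p) - a (-1)) * Polynomial.X ^ k with hP
  have hz : ∑ j, ep p j = 0 := by
    simp only [ep_eq_stdAddChar]
    refine AddChar.sum_eq_zero_of_ne_one ?_
    rw [AddChar.ne_one_iff]
    refine ⟨1, ?_⟩
    rw [← ep_eq_stdAddChar]
    exact (isPrimitiveRoot_ep_one p).ne_one hp.one_lt
  have h1 : Polynomial.aeval (ep p 1) P = 0 := by
    have : ∑ j, ((a j - a (-1) : ℤ) : ℂ) * ep p j = 0 := by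
      push_cast
      simp only [sub_mul, Finset.sum_sub_distrib, h, ← Finset.mul_sum, hz]
      simp
    rw [sum_zmod_eq_sum_range] at this
    simp only [ep_natCast] at this
    rw [hP, map_sum, ← this]
    refine Finset.sum_congr rfl fun k _ => ?_
    simp
  have hcoeff : ∀ k, k < p → P.coeff k = a (k : ZMod p) - a (-1) := by
    intro k hk
    simp only [hP, Polynomial.finsetSum_coeff, Polynomial.coeff_C_mul, Polynomial.coeff_X_pow,
      mul_ite, mul_one, mul_zero, Finset.sum_ite_eq, Finset.mem_range, hk, if_true]
  have hdeg : P.degree < (Polynomial.cyclotomic p ℤ).degree := by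
    rw [Polynomial.degree_cyclotomic, Nat.totient_prime hp, Polynomial.degree_lt_iff_coeff_zero]
    intro k hk
    rcases lt_or_ge k p with hk' | hk'
    · have hk1 : p - 1 ≤ k := by exact_mod_cast hk
      have : k = p - 1 := by omega
      rw [hcoeff k hk', this, Nat.cast_sub hp.one_le]
      simp
    · simp only [hP, Polynomial.finsetSum_coeff, Polynomial.coeff_C_mul, Polynomial.coeff_X_pow,
        mul_ite, mul_one, mul_zero, Finset.sum_ite_eq, Finset.mem_range, hk'.not_gt, if_false]
  have h0 := Polynomial.eq_zero_of_dvd_of_degree_lt (cyclotomic_dvd_of_aeval_ep p h1) hdeg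
  have := hcoeff i.val (ZMod.val_lt i)
  rw [h0] at this
  simp at this
  linarith

section EulerOperator

open Polynomial

variable {R : Type*} [CommRing R]

/-- The Euler operator `X · d/dX` on polynomials. -/
def eulerOp (P : R[X]) : R[X] := X * derivative P

lemma iterate_eulerOp_X_sub_one_pow (N k : ℕ) (hk : k ≤ N) :
    ∃ H : R[X], eulerOp^[k] ((X - 1) ^ N) = (X - 1) ^ (N - k) * H ∧
      H.eval 1 = (N.descFactorial k : R) := by
  induction k with
  | zero => exact ⟨1, by simp⟩
  | succ k ih =>
    obtain ⟨H, h1, h2⟩ := ih (by omega)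
    refine ⟨X * (((N - k : ℕ) : R[X]) * H + (X - 1) * derivative H), ?_, ?_⟩
    · obtain ⟨d, hd⟩ : ∃ d, N - k = d + 1 := ⟨N - k - 1, by omega⟩
      rw [Function.iterate_succ_apply', h1, eulerOp, show N - (k + 1) = d by omega, hd,
        derivative_mul, derivative_pow_succ]
      simp
      ring
    · simp [h2, Nat.descFactorial_succ]

lemma iterate_eulerOp_sum_X_pow (N k : ℕ) :
    eulerOp^[k] (∑ j ∈ Finset.range N, (X : R[X]) ^ j) =
      ∑ j ∈ Finset.range N, C ((j : R) ^ k) * X ^ j := by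
  induction k with
  | zero => simp
  | succ k ih =>
    rw [Function.iterate_succ_apply', ih, eulerOp, derivative_sum, Finset.mul_sum]
    refine Finset.sum_congr rfl fun j _ => ?_
    rw [derivative_C_mul_X_pow]
    rcases j with _ | j
    · simp
    · simp; ring

lemma prod_X_pow_sub_X_pow {ι : Type*} (s : Finset ι) (a b : ι → ℕ) :
    ∃ H : R[X], ∏ i ∈ s, ((X : R[X]) ^ a i - X ^ b i) = (X - 1) ^ s.card * H ∧
      H.eval 1 = ∏ i ∈ s, ((a i : R) - b i) := by
  refine ⟨∏ i ∈ s, (∑ j ∈ Finset.range (a i), X ^ j - ∑ j ∈ Finset.range (b i), X ^ j), ?_, ?_⟩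
  · rw [← Finset.prod_const, ← Finset.prod_mul_distrib]
    refine Finset.prod_congr rfl fun i _ => ?_
    rw [mul_sub, mul_geom_sum, mul_geom_sum]
    ring
  · simp [eval_prod, eval_finsetSum]

lemma sum_X_pow_range_prime (p : ℕ) [Fact p.Prime] :
    ∑ j ∈ Finset.range p, (X : (ZMod p)[X]) ^ j = (X - 1) ^ (p - 1) := by
  have hp := (Fact.out : p.Prime)
  have h0 : (X - 1 : (ZMod p)[X]) ≠ 0 := by simpa using X_sub_C_ne_zero (1 : ZMod p)
  apply mul_left_cancel₀ h0
  rw [mul_geom_sum, ← pow_succ', Nat.sub_add_cancel hp.one_le, sub_pow_char, one_pow]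

end EulerOperator

/-- The quadratic Gauss sum of `ZMod p` for the character `ep p`. -/
def quadGaussSum (p : ℕ) [Fact p.Prime] : ℂ := ∑ j : ZMod p, eta0 p j * ep p j

/-- The product of sines whose comparison with the Gauss sum determines the sign of the latter. -/
def sineProd (p : ℕ) : ℂ :=
  ∏ k ∈ Finset.range ((p - 1) / 2),
    (ep p 1 ^ ((k + 1) * ((p + 1) / 2)) - ep p 1 ^ ((p - 1) * ((k + 1) * ((p + 1) / 2))))

section Sign

open Polynomial

variable (p : ℕ) [Fact p.Prime]

lemma ringChar_zmod_ne_two (hp2 : p ≠ 2) : ringChar (ZMod p) ≠ 2 := by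
  rwa [ZMod.ringChar_zmod_n]

lemma quadraticChar_cast_eq_pow (hp2 : p ≠ 2) (a : ZMod p) :
    ((quadraticChar (ZMod p) a : ℤ) : ZMod p) = a ^ ((p - 1) / 2) := by
  have hp := (Fact.out : p.Prime)
  have hodd := hp.eq_two_or_odd.resolve_left hp2
  rw [quadraticChar_eq_pow_of_char_ne_two' (ringChar_zmod_ne_two p hp2), ZMod.card]
  congr 1; omega

lemma sign_of_quadGaussSum_eq (hp2 : p ≠ 2) (e : ℤ)
    (h : quadGaussSum p = e * sineProd p) : (e : ZMod p) = (-1) ^ ((p - 1) / 2) := by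
  have hp := (Fact.out : p.Prime)
  have hodd := hp.eq_two_or_odd.resolve_left hp2
  have hp3 : 3 ≤ p := by have := hp.two_le; omega
  set m := (p - 1) / 2 with hm
  set r := (p + 1) / 2 with hr
  set P : ℤ[X] := ∑ k ∈ Finset.range p, C (quadraticChar (ZMod p) (k : ZMod p)) * X ^ k -
    C e * ∏ k ∈ Finset.range m, (X ^ ((k + 1) * r) - X ^ ((p - 1) * ((k + 1) * r))) with hP
  have h1 : aeval (ep p 1) P = 0 := by
    have : ∑ k ∈ Finset.range p, ((quadraticChar (ZMod p) (k : ZMod p) : ℤ) : ℂ) * ep p 1 ^ k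
        = e * sineProd p := by
      rw [← h, quadGaussSum, sum_zmod_eq_sum_range]
      simp only [ep_natCast, eta0]
    rw [hP, map_sub, map_sum, sub_eq_zero]
    simpa [map_prod, sineProd] using this
  obtain ⟨Q, hQ⟩ := cyclotomic_dvd_of_aeval_ep p h1
  have hQ' := congrArg (Polynomial.map (Int.castRingHom (ZMod p))) hQ
  rw [Polynomial.map_mul, map_cyclotomic, cyclotomic_prime, sum_X_pow_range_prime, hP] at hQ'
  simp only [Polynomial.map_sub, Polynomial.map_sum, Polynomial.map_mul, Polynomial.map_pow,
    map_X, Polynomial.map_prod, map_C, Int.coe_castRingHom, quadraticChar_cast_eq_pow p hp2] at hQ'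
  obtain ⟨H, hH, hH1⟩ := prod_X_pow_sub_X_pow (R := ZMod p) (Finset.range m)
    (fun k => (k + 1) * r) (fun k => (p - 1) * ((k + 1) * r))
  obtain ⟨K, hK, hK1⟩ := iterate_eulerOp_X_sub_one_pow (R := ZMod p) (p - 1) m (by omega)
  simp only [← hm] at hQ'
  rw [← iterate_eulerOp_sum_X_pow, sum_X_pow_range_prime, hK, hH, Finset.card_range,
    show p - 1 - m = m by omega, show p - 1 = m + m by omega,
    pow_add] at hQ'
  have h0 : (X - 1 : (ZMod p)[X]) ^ m ≠ 0 :=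
    pow_ne_zero _ (by simpa using X_sub_C_ne_zero (1 : ZMod p))
  have hKH : K - C (e : ZMod p) * H = (X - 1) ^ m * Q.map (Int.castRingHom (ZMod p)) := by
    apply mul_left_cancel₀ h0
    rw [← mul_assoc, ← hQ']; ring
  have hev := congrArg (eval (1 : ZMod p)) hKH
  have hm0 : m ≠ 0 := by omega
  simp only [eval_sub, eval_mul, eval_pow, eval_X, eval_one, sub_self, zero_pow hm0, zero_mul,
    hK1, hH1, eval_C] at hev
  have hpz : (p : ZMod p) = 0 := ZMod.natCast_self p
  have hprod : ∏ i ∈ Finset.range m,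
      ((((i + 1) * r : ℕ) : ZMod p) - (((p - 1) * ((i + 1) * r) : ℕ) : ZMod p))
      = (m.factorial : ZMod p) := by
    rw [← Finset.prod_range_add_one_eq_factorial, Nat.cast_prod]
    refine Finset.prod_congr rfl fun i _ => ?_
    have h2r : (2 : ZMod p) * r = 1 := by
      have : 2 * r = p + 1 := by omega
      have := congrArg (Nat.cast (R := ZMod p)) this
      push_cast at this
      rw [this, hpz]; simp
    push_cast [Nat.cast_sub hp.one_le]
    rw [hpz]
    linear_combination ((i : ZMod p) + 1) * h2r
  have hdesc : ((p - 1).descFactorial m : ZMod p) = (-1) ^ m * (m.factorial : ZMod p) := by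
    rw [Nat.descFactorial_eq_prod_range, ← Finset.prod_range_add_one_eq_factorial, Nat.cast_prod,
      Nat.cast_prod]
    rw [← Finset.card_range m, ← Finset.prod_const, Finset.card_range, ← Finset.prod_mul_distrib]
    refine Finset.prod_congr rfl fun i hi => ?_
    have := Finset.mem_range.1 hi
    rw [Nat.cast_sub (by omega), Nat.cast_sub hp.one_le, hpz]
    push_cast; ring
  have hfac : (m.factorial : ZMod p) ≠ 0 := by
    rw [Ne, ZMod.natCast_eq_zero_iff, hp.dvd_factorial]
    omega
  rw [hprod, hdesc] at hev
  apply mul_right_cancel₀ hfac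
  linear_combination -hev

end Sign

section GaussSumValue

variable (p : ℕ) [Fact p.Prime]

lemma quadGaussSum_sq (hp2 : p ≠ 2) : quadGaussSum p ^ 2 = (-1) ^ ((p - 1) / 2) * p := by
  have hp := (Fact.out : p.Prime)
  have hodd := hp.eq_two_or_odd.resolve_left hp2
  have hinj : Function.Injective (Int.castRingHom ℂ) := Int.cast_injective
  set χ := (quadraticChar (ZMod p)).ringHomComp (Int.castRingHom ℂ) with hχ
  have h1 : χ ≠ 1 := (MulChar.ringHomComp_ne_one_iff hinj).2
    (quadraticChar_ne_one (ringChar_zmod_ne_two p hp2))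
  have h2 : χ.IsQuadratic := (quadraticChar_isQuadratic (ZMod p)).comp _
  have h := gaussSum_sq h1 h2 (ZMod.isPrimitive_stdAddChar p)
  have hG : quadGaussSum p = gaussSum χ ZMod.stdAddChar := by
    simp [quadGaussSum, gaussSum, eta0, ep_eq_stdAddChar, hχ]
  have hneg : quadraticChar (ZMod p) (-1) = (-1) ^ ((p - 1) / 2) := by
    rw [quadraticChar_neg_one (ringChar_zmod_ne_two p hp2), ZMod.card,
      ZMod.χ₄_eq_neg_one_pow hodd]
    congr 1; omega
  rw [hG, h, ZMod.card, hχ, MulChar.ringHomComp_apply, hneg]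
  simp

lemma sineProd_sq (hp2 : p ≠ 2) : sineProd p ^ 2 = (-1) ^ ((p - 1) / 2) * p := by
  have hp := (Fact.out : p.Prime)
  have hodd := hp.eq_two_or_odd.resolve_left hp2
  have hζ := isPrimitiveRoot_ep_one p
  obtain ⟨m, rfl⟩ : ∃ m, p = m + m + 1 := ⟨(p - 1) / 2, by have := hp.two_le; omega⟩
  have hpr := hζ.prod_one_sub_pow_eq_order
  rw [Finset.prod_range_add, ← Finset.prod_range_reflect (n := m)
    (f := fun x => 1 - ep (m + m + 1) 1 ^ (m + x + 1)), ← Finset.prod_mul_distrib] at hpr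
  rw [show (m + m + 1 - 1) / 2 = m by omega, Nat.cast_add_one, ← hpr, sineProd,
    show (m + m + 1 - 1) / 2 = m by omega, show (m + m + 1 + 1) / 2 = m + 1 by omega,
    show m + m + 1 - 1 = m + m by omega, ← Finset.prod_pow]
  have hconst : (-1 : ℂ) ^ m = ∏ _k ∈ Finset.range m, (-1 : ℂ) := by simp
  rw [hconst, ← Finset.prod_mul_distrib]
  refine Finset.prod_congr rfl fun k hk => ?_
  have hk := Finset.mem_range.1 hk
  set ζ := ep (m + m + 1) 1 with hζd
  have hp1 : ζ ^ (m + m + 1) = 1 := hζ.pow_eq_one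
  have ha : (ζ ^ ((k + 1) * (m + 1))) ^ 2 = ζ ^ (k + 1) := by
    rw [← pow_mul, show (k + 1) * (m + 1) * 2 = (m + m + 1) * (k + 1) + (k + 1) by ring,
      pow_add, pow_mul, hp1]; simp
  have hab : ζ ^ ((k + 1) * (m + 1)) * ζ ^ ((m + m) * ((k + 1) * (m + 1))) = 1 := by
    rw [← pow_add, show (k + 1) * (m + 1) + (m + m) * ((k + 1) * (m + 1)) =
      (m + m + 1) * ((k + 1) * (m + 1)) by ring, pow_mul, hp1, one_pow]
  have hc : ζ ^ (k + 1) * ζ ^ (m + (m - 1 - k) + 1) = 1 := by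
    rw [← pow_add, show k + 1 + (m + (m - 1 - k) + 1) = m + m + 1 by omega, hp1]
  generalize ζ ^ ((k + 1) * (m + 1)) = a at *
  generalize ζ ^ ((m + m) * ((k + 1) * (m + 1))) = b at *
  have hb : b ^ 2 = ζ ^ (m + (m - 1 - k) + 1) := by
    have h0 : ζ ^ (k + 1) ≠ 0 := left_ne_zero_of_mul_eq_one hc
    apply mul_left_cancel₀ h0
    rw [hc, ← ha, ← mul_pow, hab, one_pow]
  rw [← ha, ← hb]
  linear_combination (a * b - 1) * hab

lemma sign_factor (t : ℕ) :
    ((-1) ^ (2 * t) * ((∏ k ∈ Finset.range (2 * t), (-1) ^ (k + 1)) * Complex.I ^ (2 * t)) = 1) ∧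
    ((-1) ^ (2 * t + 1) * ((∏ k ∈ Finset.range (2 * t + 1), (-1) ^ (k + 1)) *
      Complex.I ^ (2 * t + 1)) = Complex.I) := by
  have h1 : ∀ t, (∏ k ∈ Finset.range (2 * t), (-1 : ℂ) ^ (k + 1)) * Complex.I ^ (2 * t) = 1 := by
    intro t
    induction t with
    | zero => simp
    | succ t ih =>
      rw [show 2 * (t + 1) = 2 * t + 1 + 1 by ring, Finset.prod_range_succ,
        Finset.prod_range_succ]
      have h2 : ((-1 : ℂ)) ^ (2 * t) = 1 := by rw [pow_mul]; simp
      linear_combination (-(-1 : ℂ) ^ (2 * t) * (-1) ^ (2 * t) * Complex.I ^ 2) * ih -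
        (-1) ^ (2 * t) * (-1) ^ (2 * t) * Complex.I_sq + ((-1) ^ (2 * t) + 1) * h2
  have h2 : ((-1 : ℂ)) ^ (2 * t) = 1 := by rw [pow_mul]; simp
  refine ⟨by rw [h1 t, h2, one_mul], ?_⟩
  rw [Finset.prod_range_succ]
  linear_combination ((-1 : ℂ) ^ (2 * t) * (-1) ^ (2 * t) * Complex.I) * h1 t +
    ((-1) ^ (2 * t) + 1) * Complex.I * h2

lemma exists_sineProd_eq (hp2 : p ≠ 2) : ∃ S : ℝ, 0 < S ∧
    sineProd p = (∏ k ∈ Finset.range ((p - 1) / 2), (-1) ^ (k + 1)) *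
      Complex.I ^ ((p - 1) / 2) * S := by
  have hp := (Fact.out : p.Prime)
  have hodd := hp.eq_two_or_odd.resolve_left hp2
  have hp0 : (p : ℂ) ≠ 0 := by exact_mod_cast hp.ne_zero
  have hpR : (0 : ℝ) < p := by exact_mod_cast hp.pos
  refine ⟨∏ k ∈ Finset.range ((p - 1) / 2), 2 * Real.sin (Real.pi * (k + 1 : ℕ) / p), ?_, ?_⟩
  · refine Finset.prod_pos fun k hk => ?_
    have hk := Finset.mem_range.1 hk
    have hkp : ((k + 1 : ℕ) : ℝ) < p := by exact_mod_cast (show k + 1 < p by omega)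
    have := Real.sin_pos_of_pos_of_lt_pi (x := Real.pi * (k + 1 : ℕ) / p) (by positivity) (by
      rw [div_lt_iff₀ hpR]; exact mul_lt_mul_of_pos_left hkp Real.pi_pos)
    positivity
  · have hconst : Complex.I ^ ((p - 1) / 2) =
        ∏ _k ∈ Finset.range ((p - 1) / 2), Complex.I := by simp
    rw [hconst, sineProd, Complex.ofReal_prod, ← Finset.prod_mul_distrib,
      ← Finset.prod_mul_distrib]
    refine Finset.prod_congr rfl fun k hk => ?_
    have hw : ep p 1 ^ ((p + 1) / 2) = -Complex.exp (Real.pi / p * Complex.I) := by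
      have : Fact (1 < p) := ⟨hp.one_lt⟩
      have h2 : (((p + 1) / 2 : ℕ) : ℂ) = (p + 1) / 2 := by
        have : 2 * ((p + 1) / 2) = p + 1 := by omega
        have := congrArg (Nat.cast (R := ℂ)) this
        push_cast at this
        linear_combination this / 2
      rw [ep, ZMod.val_one, ← Complex.exp_nat_mul, h2, neg_eq_neg_one_mul, ← Complex.exp_pi_mul_I,
        ← Complex.exp_add]
      congr 1
      push_cast
      field_simp
    generalize k + 1 = k
    have ha : ep p 1 ^ (k * ((p + 1) / 2)) =
        (-1) ^ k * Complex.exp ((Real.pi * k / p : ℝ) * Complex.I) := by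
      rw [mul_comm, pow_mul, hw, neg_pow, ← Complex.exp_nat_mul]
      congr 2; push_cast; ring
    have hb : ep p 1 ^ ((p - 1) * (k * ((p + 1) / 2))) =
        (-1) ^ k * Complex.exp (-(Real.pi * k / p : ℝ) * Complex.I) := by
      have h0 : ep p 1 ^ (k * ((p + 1) / 2)) ≠ 0 :=
        pow_ne_zero _ ((isPrimitiveRoot_ep_one p).ne_zero hp.ne_zero)
      apply mul_left_cancel₀ h0
      rw [← pow_add, show k * ((p + 1) / 2) + (p - 1) * (k * ((p + 1) / 2)) =
        (p - 1 + 1) * (k * ((p + 1) / 2)) by ring, Nat.sub_add_cancel hp.one_le, pow_mul,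
        (isPrimitiveRoot_ep_one p).pow_eq_one, one_pow, ha, mul_mul_mul_comm, ← Complex.exp_add,
        ← mul_pow]
      simp
    rw [ha, hb]
    push_cast
    rw [Complex.sin]
    linear_combination (-(-1) ^ k * (Complex.exp (-(Real.pi * k / p) * Complex.I) -
      Complex.exp ((Real.pi * k / p) * Complex.I))) * Complex.I_sq

/-- The value, sign included, of the quadratic Gauss sum. -/
lemma quadGaussSum_eq_sqrtPStar (hp2 : p ≠ 2) : quadGaussSum p = sqrtPStar p := by
  have hp := (Fact.out : p.Prime)
  have hodd := hp.eq_two_or_odd.resolve_left hp2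
  have hp3 : 3 ≤ p := by have := hp.two_le; omega
  have hsq : quadGaussSum p = (-1) ^ ((p - 1) / 2) * sineProd p := by
    have key : ∀ e : ℤ, (e = 1 ∨ e = -1) → quadGaussSum p = e * sineProd p →
        quadGaussSum p = (-1) ^ ((p - 1) / 2) * sineProd p := by
      intro e he h
      have hs := sign_of_quadGaussSum_eq p hp2 e h
      have : e = (-1) ^ ((p - 1) / 2) := by
        have h1 : ((e - (-1) ^ ((p - 1) / 2) : ℤ) : ZMod p) = 0 := by push_cast; rw [hs, sub_self]
        rw [ZMod.intCast_zmod_eq_zero_iff_dvd] at h1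
        have h2 := Int.eq_zero_of_abs_lt_dvd h1 (by
          rcases he with rfl | rfl <;> rcases neg_one_pow_eq_or ℤ ((p - 1) / 2) with h | h <;>
            rw [h] <;> norm_num <;> omega)
        linarith
      rw [h, this]; push_cast; rfl
    rcases sq_eq_sq_iff_eq_or_eq_neg.1 ((quadGaussSum_sq p hp2).trans (sineProd_sq p hp2).symm)
      with h | h
    · exact key 1 (Or.inl rfl) (by rw [h]; simp)
    · exact key (-1) (Or.inr rfl) (by rw [h]; simp)
  obtain ⟨S, hS, hSP⟩ := exists_sineProd_eq p hp2
  have hSS : S = Real.sqrt p := by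
    have h := sineProd_sq p hp2
    rw [hSP, mul_pow, mul_pow, ← pow_mul, mul_comm ((p - 1) / 2) 2, pow_mul, Complex.I_sq,
      ← Finset.prod_pow] at h
    have h1 : ∏ x ∈ Finset.range ((p - 1) / 2), ((-1 : ℂ) ^ (x + 1)) ^ 2 = 1 :=
      Finset.prod_eq_one fun k _ => by rw [← pow_mul, mul_comm, pow_mul]; simp
    rw [h1, one_mul] at h
    have h2 := mul_left_cancel₀ (pow_ne_zero _ (by norm_num)) h
    have h3 : S ^ 2 = p := by exact_mod_cast h2
    rw [← h3, Real.sqrt_sq hS.le]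
  rw [hsq, hSP, hSS, sqrtPStar, ← mul_assoc]
  split_ifs with h4
  · have := (sign_factor ((p - 1) / 4)).1
    rw [show 2 * ((p - 1) / 4) = (p - 1) / 2 by omega] at this
    rw [this, one_mul]
  · have := (sign_factor ((p - 1) / 4)).2
    rw [show 2 * ((p - 1) / 4) + 1 = (p - 1) / 2 by omega] at this
    rw [this]

end GaussSumValue

section Character

variable (p : ℕ) [Fact p.Prime]

lemma sum_quadraticChar_mul_sub (hp2 : p ≠ 2) (c : ZMod p) :
    ∑ j, quadraticChar (ZMod p) j * quadraticChar (ZMod p) (j - c) =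
      if c = 0 then (p : ℤ) - 1 else -1 := by
  have hr := ringChar_zmod_ne_two p hp2
  split_ifs with hc
  · subst hc
    have h : ∀ j : ZMod p, quadraticChar (ZMod p) j * quadraticChar (ZMod p) (j - 0) =
        1 - if j = 0 then 1 else 0 := by
      intro j
      rw [sub_zero, ← sq]
      split_ifs with hj
      · simp [hj]
      · rw [quadraticChar_sq_one hj, sub_zero]
    rw [Finset.sum_congr rfl fun j _ => h j]
    simp [Finset.sum_sub_distrib, ZMod.card]
  · have h := jacobiSum_nontrivial_inv (quadraticChar_ne_one hr)
    rw [(quadraticChar_isQuadratic (ZMod p)).inv, jacobiSum] at h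
    have h1 : (quadraticChar (ZMod p)) (-1) ^ 2 = 1 := quadraticChar_sq_one (by simp)
    have h2 : quadraticChar (ZMod p) c ^ 2 = 1 := quadraticChar_sq_one hc
    rw [← Equiv.sum_comp (Equiv.mulLeft₀ c hc)]
    have h3 : ∀ i : ZMod p, quadraticChar (ZMod p) (Equiv.mulLeft₀ c hc i) *
        quadraticChar (ZMod p) (Equiv.mulLeft₀ c hc i - c) =
        quadraticChar (ZMod p) (-1) * (quadraticChar (ZMod p) i * quadraticChar (ZMod p) (1 - i)) := by
      intro i
      have : Equiv.mulLeft₀ c hc i - c = c * (-1) * (1 - i) := by simp; ring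
      rw [this]
      rw [show Equiv.mulLeft₀ c hc i = c * i from rfl]
      simp only [map_mul]
      linear_combination (quadraticChar (ZMod p) (-1) *
        (quadraticChar (ZMod p) i * quadraticChar (ZMod p) (1 - i))) * h2
    rw [Finset.sum_congr rfl fun i _ => h3 i, ← Finset.mul_sum, h]
    linear_combination -h1

lemma sum_quadraticChar_sub (hp2 : p ≠ 2) (c : ZMod p) :
    ∑ j, quadraticChar (ZMod p) (j - c) = 0 := by
  rw [← quadraticChar_sum_zero (ringChar_zmod_ne_two p hp2)]
  exact (Equiv.subRight c).sum_comp (fun j => quadraticChar (ZMod p) j)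

lemma two_mul_sum_square (F : ZMod p → ℤ) :
    2 * ∑ j with j ≠ 0 ∧ IsSquare j, F j =
      ∑ j, F j + ∑ j, quadraticChar (ZMod p) j * F j - F 0 := by
  have h : ∀ j, 2 * (if j ≠ 0 ∧ IsSquare j then F j else 0) =
      F j + quadraticChar (ZMod p) j * F j - if j = 0 then F 0 else 0 := by
    intro j
    by_cases hj : j = 0
    · simp [hj]
    · by_cases hs : IsSquare j
      · rw [(quadraticChar_one_iff_isSquare hj).2 hs]; simp [hj, hs]; ring
      · rw [quadraticChar_neg_one_iff_not_isSquare.2 hs]; simp [hj, hs]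
  rw [Finset.sum_filter, Finset.mul_sum, Finset.sum_congr rfl fun j _ => h j,
    Finset.sum_sub_distrib, Finset.sum_add_distrib]
  simp

lemma two_mul_sum_square_quadraticChar (hp2 : p ≠ 2) (c : ZMod p) :
    2 * ∑ j with j ≠ 0 ∧ IsSquare j, quadraticChar (ZMod p) (j - c) =
      if c = 0 then (p : ℤ) - 1 else -1 - quadraticChar (ZMod p) (-c) := by
  rw [two_mul_sum_square, sum_quadraticChar_sub p hp2, sum_quadraticChar_mul_sub p hp2]
  split_ifs with hc
  · simp [hc]
  · simp

lemma two_mul_card_square (hp2 : p ≠ 2) :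
    2 * ((Finset.univ.filter fun j : ZMod p => j ≠ 0 ∧ IsSquare j).card : ℤ) = p - 1 := by
  have h := two_mul_sum_square p (fun _ => 1)
  simp only [mul_one, quadraticChar_sum_zero (ringChar_zmod_ne_two p hp2)] at h
  simpa [ZMod.card] using h

end Character

section Trace

variable (p : ℕ) [Fact p.Prime] {F : Type*} [Field F] [Fintype F] [Algebra (ZMod p) F]

lemma card_trace_fiber {n : ℕ} (hn : 0 < n) (hq : Fintype.card F = p ^ n) {x : F} (hx : x ≠ 0)
    (c : ZMod p) :
    (Finset.univ.filter fun β : F => Algebra.trace (ZMod p) F (β * x) = c).card = p ^ (n - 1) := by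
  have hp := (Fact.out : p.Prime)
  have hsurj : Function.Surjective
      ((Algebra.trace (ZMod p) F).toAddMonoidHom.comp (AddMonoidHom.mulRight x)) := by
    intro c
    obtain ⟨y, hy⟩ := Algebra.trace_surjective (ZMod p) F c
    exact ⟨y / x, by simpa [hx] using hy⟩
  set φ := (Algebra.trace (ZMod p) F).toAddMonoidHom.comp (AddMonoidHom.mulRight x) with hφ
  have heq : ∀ d, (Finset.univ.filter fun β : F => Algebra.trace (ZMod p) F (β * x) = d).card =
      (Finset.univ.filter fun β : F => Algebra.trace (ZMod p) F (β * x) = c).card := fun d =>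
    AddMonoidHom.card_fiber_eq_of_mem_range φ (hsurj d) (hsurj c)
  have hsum := Finset.card_eq_sum_card_fiberwise (s := (Finset.univ : Finset F))
    (t := (Finset.univ : Finset (ZMod p)))
    (f := fun β => Algebra.trace (ZMod p) F (β * x)) (fun _ _ => Finset.mem_univ _)
  rw [Finset.sum_congr rfl fun d _ => heq d, Finset.sum_const, Finset.card_univ, Finset.card_univ,
    hq, ZMod.card, smul_eq_mul] at hsum
  apply Nat.eq_of_mul_eq_mul_left hp.pos
  rw [← hsum, ← pow_succ', Nat.sub_add_cancel hn]

/-- The number of `x` at which `f x - Tr(β x)` takes the value `j`. -/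
def shiftCount (f : F → ZMod p) (β : F) (j : ZMod p) : ℤ :=
  ((Finset.univ.filter fun x => f x - Algebra.trace (ZMod p) F (β * x) = j).card : ℤ)

lemma walsh_eq_sum_shiftCount (f : F → ZMod p) (β : F) :
    walsh p f β = ∑ j, (shiftCount p f β j : ℂ) * ep p j := by
  rw [walsh, ← Finset.sum_fiberwise (s := Finset.univ)
    (g := fun x => f x - Algebra.trace (ZMod p) F (β * x))]
  refine Finset.sum_congr rfl fun j _ => ?_
  rw [Finset.sum_congr rfl (g := fun _ => ep p j), Finset.sum_const, shiftCount]
  · simp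
  · intro x hx
    rw [(Finset.mem_filter.1 hx).2]

lemma sum_shiftCount (f : F → ZMod p) (β : F) :
    ∑ j, shiftCount p f β j = Fintype.card F := by
  rw [← Finset.card_univ, Finset.card_eq_sum_card_fiberwise (s := (Finset.univ : Finset F))
    (t := (Finset.univ : Finset (ZMod p)))
    (f := fun x => f x - Algebra.trace (ZMod p) F (β * x)) (fun _ _ => Finset.mem_univ _)]
  simp [shiftCount]

/-- The indicator function of the Walsh support. -/
def walshInd (f : F → ZMod p) (β : F) : ℤ := if walsh p f β = 0 then 0 else 1

lemma shiftCount_eq_of_plateaued {n s : ℕ} (hp2 : p ≠ 2) (hn : 0 < n)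
    (hq : Fintype.card F = p ^ n) {f g : F → ZMod p} {ε : ℂ}
    (hf : IsWeaklyRegularPlateaued p n s f ε g) {N : ℕ} (hN : n + s = 2 * N + 1) :
    ∃ A : ℤ, (A = 1 ∨ A = -1) ∧ (A : ℂ) = ε * eta0 p (-1) ^ N ∧ ∀ β j,
      shiftCount p f β j = p ^ (n - 1) +
        A * p ^ N * (walshInd p f β * quadraticChar (ZMod p) (j - g β)) := by
  have hp := (Fact.out : p.Prime)
  have hp0 : (p : ℤ) ≠ 0 := by exact_mod_cast hp.ne_zero
  have hodd := hp.eq_two_or_odd.resolve_left hp2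
  obtain ⟨hε, h1, -⟩ := hf
  obtain ⟨e, he, rfl⟩ : ∃ e : ℤ, (e = 1 ∨ e = -1) ∧ ε = e := by
    rcases hε with rfl | rfl
    · exact ⟨1, Or.inl rfl, by simp⟩
    · exact ⟨-1, Or.inr rfl, by simp⟩
  have hneg : quadraticChar (ZMod p) (-1) = (-1) ^ ((p - 1) / 2) := by
    rw [quadraticChar_neg_one (ringChar_zmod_ne_two p hp2), ZMod.card,
      ZMod.χ₄_eq_neg_one_pow hodd]
    congr 1; omega
  set A : ℤ := e * quadraticChar (ZMod p) (-1) ^ N with hA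
  have hpow : (e : ℂ) * sqrtPStar p ^ (n + s) = (A * p ^ N : ℤ) * quadGaussSum p := by
    rw [hN, pow_succ, pow_mul, ← quadGaussSum_eq_sqrtPStar p hp2, quadGaussSum_sq p hp2, mul_pow,
      hA, hneg]
    push_cast
    ring
  refine ⟨A, ?_, by simp [hA, eta0], fun β j => ?_⟩
  · rw [hA]
    rcases he with rfl | rfl <;>
      rcases quadraticChar_dichotomy (F := ZMod p) (a := -1) (by simp) with h | h <;> rw [h] <;>
      rcases neg_one_pow_eq_or ℤ N with h' | h' <;> simp [h']
  have hW : walsh p f β = ∑ j, ((A * p ^ N * (walshInd p f β *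
      quadraticChar (ZMod p) (j - g β)) : ℤ) : ℂ) * ep p j := by
    by_cases hβ : walsh p f β = 0
    · simp [walshInd, hβ]
    · rw [h1 β hβ, hpow, quadGaussSum, mul_assoc, Finset.sum_mul, Finset.mul_sum]
      rw [← Equiv.sum_comp (Equiv.subRight (g β))]
      refine Finset.sum_congr rfl fun j _ => ?_
      have hadd : ep p (j - g β) * ep p (g β) = ep p j := by
        simp only [ep_eq_stdAddChar, ← AddChar.map_add_eq_mul, sub_add_cancel]
      simp only [walshInd, hβ, if_false, Equiv.subRight_apply, one_mul, eta0, ← hadd]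
      push_cast
      ring
  set a : ZMod p → ℤ := fun j => shiftCount p f β j -
    A * p ^ N * (walshInd p f β * quadraticChar (ZMod p) (j - g β)) with ha
  have hconst := eq_of_sum_mul_ep_eq_zero p a (by
    have := walsh_eq_sum_shiftCount p f β
    rw [hW, eq_comm, ← sub_eq_zero, ← Finset.sum_sub_distrib] at this
    rw [← this]
    refine Finset.sum_congr rfl fun j _ => ?_
    rw [← sub_mul]; simp [ha])
  have hsum : ∑ j, a j = p ^ n := by
    simp only [ha, Finset.sum_sub_distrib, sum_shiftCount, ← Finset.mul_sum,
      sum_quadraticChar_sub p hp2, hq]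
    simp
  rw [Finset.sum_congr rfl fun j _ => hconst j, Finset.sum_const, Finset.card_univ, ZMod.card,
    ← hconst j, nsmul_eq_mul] at hsum
  have hsub : a j = p ^ (n - 1) := by
    apply mul_left_cancel₀ hp0
    rw [← pow_succ', Nat.sub_add_cancel hn]
    exact hsum
  simp only [ha] at hsub
  linarith

end Trace

lemma two_ne_zero_of_algebra_zmod (p : ℕ) [Fact p.Prime] {F : Type*} [Field F]
    [Algebra (ZMod p) F] (hp2 : p ≠ 2) : (2 : F) ≠ 0 := by
  have hp := (Fact.out : p.Prime)
  have : CharP F p := charP_of_injective_algebraMap (algebraMap (ZMod p) F).injective p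
  intro h
  have h2 : ((2 : ℕ) : F) = 0 := by exact_mod_cast h
  rw [CharP.cast_eq_zero_iff F p] at h2
  exact hp2 ((Nat.prime_dvd_prime_iff_eq hp Nat.prime_two).1 h2)

section Counting

variable (p : ℕ) [Fact p.Prime] {F : Type*} [Field F] [Fintype F] [Algebra (ZMod p) F]

/-- An even function that vanishes at zero takes nonzero values an even number of times. -/
lemma even_shiftCount_zero (hp2 : p ≠ 2) {f : F → ZMod p} (h0 : f 0 = 0)
    (heven : ∀ x, f (-x) = f x) {j : ZMod p} (hj : j ≠ 0) : Even (shiftCount p f 0 j) := by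
  have h : ∑ x ∈ Finset.univ.filter (fun x => f x = j), (1 : ZMod 2) = 0 := by
    refine Finset.sum_involution (fun x _ => -x) ?_ ?_ ?_ ?_
    · intro x _; decide
    · intro x hx _ he
      have hx0 : x = 0 := by
        have h1 : (2 : F) * x = 0 := by linear_combination -he
        exact (mul_eq_zero.1 h1).resolve_left (two_ne_zero_of_algebra_zmod p hp2)
      rw [hx0, Finset.mem_filter, h0] at hx
      exact hj hx.2.symm
    · intro x hx
      simpa [heven] using hx
    · intro x _; simp
  rw [Finset.sum_const, nsmul_one, ZMod.natCast_eq_zero_iff_even] at h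
  simpa [shiftCount] using h

lemma dual_zero_eq_zero {n N : ℕ} (hp2 : p ≠ 2) {f g : F → ZMod p} (h0 : f 0 = 0)
    (heven : ∀ x, f (-x) = f x) {A : ℤ}
    (hT : ∀ β j, shiftCount p f β j = p ^ (n - 1) +
      A * p ^ N * (walshInd p f β * quadraticChar (ZMod p) (j - g β))) : g 0 = 0 := by
  by_contra hg
  have hodd := (Fact.out : p.Prime).eq_two_or_odd'.resolve_left hp2
  have h := even_shiftCount_zero p hp2 h0 heven hg
  rw [hT] at h
  simp only [sub_self, MulChar.map_zero, mul_zero, add_zero] at h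
  have h2 : Odd ((p : ℤ) ^ (n - 1)) := by exact_mod_cast hodd.pow
  exact (Int.not_even_iff_odd.2 h2) h

/-- The number of `x` at which `f x - Tr(β x)` is a nonzero square. -/
def squareCount (f : F → ZMod p) (β : F) : ℤ :=
  ((Finset.univ.filter fun x => f x - Algebra.trace (ZMod p) F (β * x) ≠ 0 ∧
    IsSquare (f x - Algebra.trace (ZMod p) F (β * x))).card : ℤ)

lemma squareCount_eq_sum (f : F → ZMod p) (β : F) :
    squareCount p f β = ∑ j with j ≠ 0 ∧ IsSquare j, shiftCount p f β j := by
  simp only [squareCount, shiftCount, ← Nat.cast_sum]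
  congr 1
  rw [Finset.card_eq_sum_card_fiberwise
    (t := Finset.univ.filter fun j : ZMod p => j ≠ 0 ∧ IsSquare j)
    (f := fun x => f x - Algebra.trace (ZMod p) F (β * x))
    (fun x hx => by simpa using hx)]
  refine Finset.sum_congr rfl fun j hj => ?_
  congr 1
  ext x
  simp only [Finset.mem_filter, Finset.mem_univ, true_and] at hj ⊢
  constructor
  · exact fun h => h.2
  · intro h; rw [h]; exact ⟨hj, rfl⟩

lemma two_mul_squareCount {n N : ℕ} (hp2 : p ≠ 2) {f g : F → ZMod p} {A : ℤ}
    (hT : ∀ β j, shiftCount p f β j = p ^ (n - 1) +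
      A * p ^ N * (walshInd p f β * quadraticChar (ZMod p) (j - g β))) (β : F) :
    2 * squareCount p f β = ((p : ℤ) - 1) * p ^ (n - 1) + A * p ^ N * (walshInd p f β *
      if g β = 0 then (p : ℤ) - 1 else -1 - quadraticChar (ZMod p) (-g β)) := by
  rw [squareCount_eq_sum, Finset.sum_congr rfl fun j _ => hT β j, Finset.sum_add_distrib,
    ← Finset.mul_sum, ← Finset.mul_sum, Finset.sum_const, nsmul_eq_mul,
    ← two_mul_sum_square_quadraticChar p hp2]
  linear_combination (p : ℤ) ^ (n - 1) * two_mul_card_square p hp2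

lemma squareCount_smul {f : F → ZMod p} {h : ℕ} (hh : 0 < h) (heven : Even h)
    (hgcd : Nat.gcd (h - 1) (p - 1) = 1)
    (hom : ∀ (a : (ZMod p)ˣ) (x : F),
      f (algebraMap (ZMod p) F (a : ZMod p) * x) = (a : ZMod p) ^ h * f x)
    (β : F) {z : ZMod p} (hz : z ≠ 0) :
    squareCount p f (algebraMap (ZMod p) F z * β) = squareCount p f β := by
  have hcop : (Nat.card (ZMod p)ˣ).Coprime (h - 1) := by
    rw [Nat.card_eq_fintype_card, ZMod.card_units]
    exact Nat.Coprime.symm hgcd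
  obtain ⟨b, hb⟩ := (powCoprime hcop).surjective (Units.mk0 z hz)
  have hbz : (b : ZMod p) ^ (h - 1) = z := by
    have := congrArg Units.val hb
    simpa using this
  have hb0 : (b : ZMod p) ≠ 0 := b.ne_zero
  have hbF : algebraMap (ZMod p) F b ≠ 0 := by simp
  have hval : ∀ x, f (algebraMap (ZMod p) F b * x) -
      Algebra.trace (ZMod p) F (algebraMap (ZMod p) F z * β * (algebraMap (ZMod p) F b * x)) =
      (b : ZMod p) ^ h * (f x - Algebra.trace (ZMod p) F (β * x)) := by
    intro x
    have h1 : algebraMap (ZMod p) F z * β * (algebraMap (ZMod p) F b * x) =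
        ((b : ZMod p) ^ h) • (β * x) := by
      rw [Algebra.smul_def, ← hbz, show h = h - 1 + 1 by omega, pow_succ, map_mul]
      simp only [Nat.add_sub_cancel]
      ring
    rw [hom, h1, map_smul, smul_eq_mul]
    ring
  have hsq : ∀ y : ZMod p, ((b : ZMod p) ^ h * y ≠ 0 ∧ IsSquare ((b : ZMod p) ^ h * y)) ↔
      (y ≠ 0 ∧ IsSquare y) := by
    intro y
    obtain ⟨k, rfl⟩ := heven
    have hbk : (b : ZMod p) ^ k ≠ 0 := pow_ne_zero _ hb0
    refine and_congr (by simp [hb0]) ⟨?_, ?_⟩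
    · rintro ⟨c, hc⟩
      refine ⟨c / (b : ZMod p) ^ k, ?_⟩
      field_simp
      rw [pow_add] at hc
      linear_combination hc
    · rintro ⟨c, rfl⟩
      exact ⟨(b : ZMod p) ^ k * c, by ring⟩
  rw [squareCount, squareCount]
  congr 1
  symm
  refine Finset.card_bij' (fun x _ => algebraMap (ZMod p) F b * x)
    (fun x _ => (algebraMap (ZMod p) F b)⁻¹ * x) ?_ ?_ ?_ ?_
  · intro x hx
    simp only [Finset.mem_filter, Finset.mem_univ, true_and] at hx ⊢
    rw [hval]; exact (hsq _).2 hx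
  · intro x hx
    simp only [Finset.mem_filter, Finset.mem_univ, true_and] at hx ⊢
    rw [← hsq, ← hval, mul_inv_cancel_left₀ hbF]
    exact hx
  · intro x _; simp [hbF]
  · intro x _; simp [hbF]

lemma card_square_line (v t : ZMod p) :
    ((Finset.univ.filter fun z : ZMod p => v - z * t ≠ 0 ∧ IsSquare (v - z * t)).card : ℤ) =
      if t = 0 then (if v ≠ 0 ∧ IsSquare v then (p : ℤ) else 0) else
        ((Finset.univ.filter fun j : ZMod p => j ≠ 0 ∧ IsSquare j).card : ℤ) := by
  split_ifs with ht hv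
  · simp [ht, hv, ZMod.card]
  · subst ht
    simp only [mul_zero, sub_zero]
    rw [Finset.filter_false_of_mem fun _ _ => hv]; simp
  · congr 1
    refine Finset.card_bij' (fun z _ => v - z * t) (fun j _ => (v - j) / t) ?_ ?_ ?_ ?_
    · intro z hz; simpa using hz
    · intro j hj
      simp only [Finset.mem_filter, Finset.mem_univ, true_and] at hj ⊢
      rwa [div_mul_cancel₀ _ ht, sub_sub_cancel]
    · intro z _; field_simp; ring
    · intro j _; field_simp; ring

/-- The sum of the square counts along the line `F_p β`. -/
lemma sum_squareCount_line {n : ℕ} (hp2 : p ≠ 2) (hn : 0 < n) (hq : Fintype.card F = p ^ n)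
    (f : F → ZMod p) {β : F} (hβ : β ≠ 0) :
    2 * ∑ z : ZMod p, squareCount p f (algebraMap (ZMod p) F z * β) =
      2 * p * (((Dsq p f).filter fun x => Algebra.trace (ZMod p) F (β * x) = 0).card : ℤ) +
        ((p : ℤ) - 1) * (p ^ n - p ^ (n - 1)) := by
  have htr : ∀ (z : ZMod p) (x : F), Algebra.trace (ZMod p) F (algebraMap (ZMod p) F z * β * x) =
      z * Algebra.trace (ZMod p) F (β * x) := by
    intro z x
    rw [mul_assoc, ← Algebra.smul_def, map_smul, smul_eq_mul]
  have hswap : ∑ z : ZMod p, squareCount p f (algebraMap (ZMod p) F z * β) =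
      ∑ x : F, ((Finset.univ.filter fun z : ZMod p =>
        f x - z * Algebra.trace (ZMod p) F (β * x) ≠ 0 ∧
        IsSquare (f x - z * Algebra.trace (ZMod p) F (β * x))).card : ℤ) := by
    simp only [squareCount, htr, Finset.card_filter, Nat.cast_sum]
    exact Finset.sum_comm
  have hker : ((Finset.univ.filter fun x : F => Algebra.trace (ZMod p) F (β * x) = 0).card : ℤ) =
      p ^ (n - 1) := by
    have := card_trace_fiber p hn hq hβ 0
    simp only [mul_comm _ β] at this
    exact_mod_cast this
  set S : ℤ := ((Finset.univ.filter fun j : ZMod p => j ≠ 0 ∧ IsSquare j).card : ℤ) with hS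
  have hpt : ∀ x : F, (if Algebra.trace (ZMod p) F (β * x) = 0 then
      (if f x ≠ 0 ∧ IsSquare (f x) then (p : ℤ) else 0) else S) =
      p * (if (f x ≠ 0 ∧ IsSquare (f x)) ∧ Algebra.trace (ZMod p) F (β * x) = 0 then 1 else 0) +
      S * (1 - if Algebra.trace (ZMod p) F (β * x) = 0 then 1 else 0) := by
    intro x
    by_cases h1 : Algebra.trace (ZMod p) F (β * x) = 0 <;>
      by_cases h2 : f x ≠ 0 ∧ IsSquare (f x) <;> simp [h1, h2]
  have hcardD : (∑ x : F, if (f x ≠ 0 ∧ IsSquare (f x)) ∧ Algebra.trace (ZMod p) F (β * x) = 0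
      then (1 : ℤ) else 0) =
      (((Dsq p f).filter fun x => Algebra.trace (ZMod p) F (β * x) = 0).card : ℤ) := by
    rw [Finset.sum_boole, Dsq, Finset.filter_filter]
    congr!
  rw [hswap, Finset.sum_congr rfl fun x _ => card_square_line p _ _,
    Finset.sum_congr rfl fun x _ => hpt x, Finset.sum_add_distrib, ← Finset.mul_sum,
    ← Finset.mul_sum, Finset.sum_sub_distrib, hcardD, Finset.sum_boole, hker]
  have h2S := two_mul_card_square p hp2
  rw [← hS] at h2S
  simp only [Finset.sum_const, Finset.card_univ, hq, nsmul_eq_mul, mul_one]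
  push_cast
  linear_combination ((p : ℤ) ^ n - p ^ (n - 1)) * h2S

/-- The weight of the codeword `c_β`. -/
lemma two_mul_wtOn {n N : ℕ} (hp2 : p ≠ 2) (hn : 2 ≤ n) (hN : 0 < N)
    (hq : Fintype.card F = p ^ n) {f g : F → ZMod p} {h : ℕ} (hh : 0 < h) (heven : Even h)
    (hgcd : Nat.gcd (h - 1) (p - 1) = 1)
    (hom : ∀ (a : (ZMod p)ˣ) (x : F),
      f (algebraMap (ZMod p) F (a : ZMod p) * x) = (a : ZMod p) ^ h * f x)
    {A : ℤ} (hT : ∀ β j, shiftCount p f β j = p ^ (n - 1) +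
      A * p ^ N * (walshInd p f β * quadraticChar (ZMod p) (j - g β)))
    (hcard : 2 * ((Dsq p f).card : ℤ) = ((p : ℤ) - 1) * (p ^ (n - 1) + A * p ^ N))
    {β : F} (hβ : β ≠ 0) :
    2 * (wtOn p (Dsq p f) β : ℤ) = ((p : ℤ) - 1) * (((p : ℤ) - 1) * p ^ (n - 2) +
      A * p ^ (N - 1) * ((p : ℤ) - 1 - walshInd p f β *
        if g β = 0 then (p : ℤ) - 1 else -1 - quadraticChar (ZMod p) (-g β))) := by
  have hp := (Fact.out : p.Prime)
  have hp0 : (p : ℤ) ≠ 0 := by exact_mod_cast hp.ne_zero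
  have hline := sum_squareCount_line p hp2 (by omega) hq f hβ
  rw [← Finset.add_sum_erase _ _ (Finset.mem_univ (0 : ZMod p)),
    Finset.sum_congr rfl (g := fun _ => squareCount p f β) (fun z hz =>
      squareCount_smul p hh heven hgcd hom β (Finset.ne_of_mem_erase hz)),
    Finset.sum_const, Finset.card_erase_of_mem (Finset.mem_univ _), Finset.card_univ, ZMod.card,
    nsmul_eq_mul, Nat.cast_sub hp.one_le, map_zero, zero_mul] at hline
  have h0 : squareCount p f 0 = (Dsq p f).card := by simp [squareCount, Dsq]
  have hβ' := two_mul_squareCount p hp2 hT β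
  have hsplit : ((Dsq p f).card : ℤ) =
      ((Dsq p f).filter fun x => Algebra.trace (ZMod p) F (β * x) = 0).card +
        wtOn p (Dsq p f) β := by
    rw [wtOn, ← Nat.cast_add]
    congr 1
    exact (Finset.card_filter_add_card_filter_not _).symm
  rw [h0] at hline
  obtain ⟨a, rfl⟩ : ∃ a, n = a + 2 := ⟨n - 2, by omega⟩
  obtain ⟨b, rfl⟩ : ∃ b, N = b + 1 := ⟨N - 1, by omega⟩
  simp only [Nat.add_sub_cancel, show a + 2 - 1 = a + 1 by omega] at *
  apply mul_left_cancel₀ hp0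
  push_cast at hline
  linear_combination (-2 * (p : ℤ)) * hsplit + hline - ((p : ℤ) - 1) * hβ' + ((p : ℤ) - 1) * hcard

end Counting

section DualSums

variable (p : ℕ) [Fact p.Prime] {F : Type*} [Field F] [Fintype F] [Algebra (ZMod p) F]

lemma shiftCount_eq_sum (f : F → ZMod p) (β : F) (j : ZMod p) :
    shiftCount p f β j =
      ∑ x, if f x - Algebra.trace (ZMod p) F (β * x) = j then (1 : ℤ) else 0 := by
  rw [Finset.sum_boole, shiftCount]

/-- Sums of the form `∑_x a_x` where all terms but one agree. -/
lemma sum_eq_of_forall_ne {F : Type*} [Fintype F] {n : ℕ} (hq : Fintype.card F = p ^ n)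
    {a : F → ℤ} {b : ℤ} (x₀ : F)
    (h : ∀ x, x ≠ x₀ → a x = b) : ∑ x, a x = a x₀ + (p ^ n - 1) * b := by
  rw [← Finset.add_sum_erase _ _ (Finset.mem_univ x₀),
    Finset.sum_congr rfl (g := fun _ => b) fun x hx => h x (Finset.ne_of_mem_erase hx),
    Finset.sum_const, Finset.card_erase_of_mem (Finset.mem_univ _), Finset.card_univ, hq,
    nsmul_eq_mul, Nat.cast_sub (Nat.one_le_pow _ _ (Fact.out : p.Prime).pos)]
  push_cast
  ring

lemma sum_shiftCount_left {n : ℕ} (hn : 0 < n) (hq : Fintype.card F = p ^ n) {f : F → ZMod p}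
    (h0 : f 0 = 0) (j : ZMod p) :
    ∑ β, shiftCount p f β j = (if j = 0 then (p : ℤ) ^ n else 0) + (p ^ n - 1) * p ^ (n - 1) := by
  simp only [shiftCount_eq_sum]
  rw [Finset.sum_comm, sum_eq_of_forall_ne p hq (b := p ^ (n - 1)) 0]
  · congr 1
    by_cases hj : j = 0
    · simp [h0, hj, hq]
    · simp [h0, hj, Ne.symm hj]
  · intro x hx
    rw [Finset.sum_boole]
    have := card_trace_fiber p hn hq hx (f x - j)
    rw [← Nat.cast_pow, ← this]
    congr 2
    ext β
    simp only [Finset.mem_filter, Finset.mem_univ, true_and]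
    constructor <;> intro h <;> linear_combination -h

lemma sum_shiftCount_sq {n : ℕ} (hn : 0 < n) (hq : Fintype.card F = p ^ n) (f : F → ZMod p) :
    ∑ β, ∑ j, shiftCount p f β j ^ 2 =
      (p : ℤ) ^ n * (p ^ n + (p ^ n - 1) * p ^ (n - 1)) := by
  have h : ∀ β, ∑ j, shiftCount p f β j ^ 2 = ∑ x, ∑ y,
      if Algebra.trace (ZMod p) F (β * (x - y)) = f x - f y then (1 : ℤ) else 0 := by
    intro β
    simp only [shiftCount_eq_sum, sq, Finset.sum_mul_sum]
    rw [Finset.sum_comm]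
    refine Finset.sum_congr rfl fun x _ => ?_
    rw [Finset.sum_comm]
    refine Finset.sum_congr rfl fun y _ => ?_
    simp only [ite_mul, one_mul, zero_mul, Finset.sum_ite_eq, Finset.mem_univ, if_true]
    refine if_congr ?_ rfl rfl
    rw [mul_sub, map_sub]
    constructor <;> intro h <;> linear_combination h
  have hx : ∀ x, ∑ y, ∑ β : F, (if Algebra.trace (ZMod p) F (β * (x - y)) = f x - f y
      then (1 : ℤ) else 0) = p ^ n + (p ^ n - 1) * p ^ (n - 1) := by
    intro x
    rw [sum_eq_of_forall_ne p hq (b := p ^ (n - 1)) x]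
    · simp [hq]
    · intro y hy
      rw [Finset.sum_boole]
      have := card_trace_fiber p hn hq (sub_ne_zero.2 hy.symm) (f x - f y)
      rw [← Nat.cast_pow, ← this]
  rw [Finset.sum_congr rfl fun β _ => h β, Finset.sum_comm,
    Finset.sum_congr rfl fun x _ => Finset.sum_comm.trans (hx x), Finset.sum_const,
    Finset.card_univ, hq, nsmul_eq_mul]
  push_cast
  ring

variable {p} {n N : ℕ} {f g : F → ZMod p} {A : ℤ}

/-- The character sum over the Walsh support attached to the dual. -/
lemma sum_walshInd_mul_quadraticChar (hn : 0 < n) (hq : Fintype.card F = p ^ n) (h0 : f 0 = 0)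
    (hT : ∀ β j, shiftCount p f β j = p ^ (n - 1) +
      A * p ^ N * (walshInd p f β * quadraticChar (ZMod p) (j - g β))) (j : ZMod p) :
    A * p ^ N * ∑ β, walshInd p f β * quadraticChar (ZMod p) (j - g β) =
      (if j = 0 then (p : ℤ) ^ n else 0) - p ^ (n - 1) := by
  have h := sum_shiftCount_left p hn hq h0 j
  rw [Finset.sum_congr rfl fun β _ => hT β j, Finset.sum_add_distrib, ← Finset.mul_sum,
    Finset.sum_const, Finset.card_univ, hq, nsmul_eq_mul] at h
  push_cast at h
  linear_combination h

lemma walshInd_sq (f : F → ZMod p) (β : F) : walshInd p f β ^ 2 = walshInd p f β := by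
  rw [walshInd]; split_ifs <;> simp

lemma sum_walshInd (hp2 : p ≠ 2) (hn : 0 < n) (hq : Fintype.card F = p ^ n) (hA : A ^ 2 = 1)
    (hT : ∀ β j, shiftCount p f β j = p ^ (n - 1) +
      A * p ^ N * (walshInd p f β * quadraticChar (ZMod p) (j - g β))) :
    (p : ℤ) ^ (2 * N) * ∑ β, walshInd p f β = p * p ^ (2 * (n - 1)) := by
  have hp := (Fact.out : p.Prime)
  have hp1 : (p : ℤ) - 1 ≠ 0 := by
    have : (1 : ℤ) < p := by exact_mod_cast hp.one_lt
    omega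
  have hsq : ∀ c : ZMod p, ∑ j, quadraticChar (ZMod p) (j - c) ^ 2 = (p : ℤ) - 1 := by
    intro c
    refine ((Equiv.subRight c).sum_comp fun j => quadraticChar (ZMod p) j ^ 2).trans ?_
    have := sum_quadraticChar_mul_sub p hp2 0
    simpa [← sq] using this
  have h := sum_shiftCount_sq p hn hq f
  have hβ : ∀ β, ∑ j, shiftCount p f β j ^ 2 =
      p * p ^ (2 * (n - 1)) + (p ^ (2 * N) * (p - 1)) * walshInd p f β := by
    intro β
    have hj : ∀ j, shiftCount p f β j ^ 2 = p ^ (2 * (n - 1)) +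
        (2 * p ^ (n - 1) * (A * p ^ N * walshInd p f β)) * quadraticChar (ZMod p) (j - g β) +
        (p ^ (2 * N) * walshInd p f β) * quadraticChar (ZMod p) (j - g β) ^ 2 := by
      intro j
      rw [hT]
      linear_combination (p ^ (2 * N) * walshInd p f β ^ 2 *
        quadraticChar (ZMod p) (j - g β) ^ 2) * hA +
        (p ^ (2 * N) * quadraticChar (ZMod p) (j - g β) ^ 2) * walshInd_sq f β
    rw [Finset.sum_congr rfl fun j _ => hj j, Finset.sum_add_distrib, Finset.sum_add_distrib,
      ← Finset.mul_sum, ← Finset.mul_sum, hsq, sum_quadraticChar_sub p hp2, Finset.sum_const,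
      Finset.card_univ, ZMod.card, nsmul_eq_mul]
    ring
  rw [Finset.sum_congr rfl fun β _ => hβ β, Finset.sum_add_distrib, Finset.sum_const,
    ← Finset.mul_sum, Finset.card_univ, hq, nsmul_eq_mul] at h
  obtain ⟨a, rfl⟩ : ∃ a, n = a + 1 := ⟨n - 1, by omega⟩
  apply mul_left_cancel₀ hp1
  push_cast at h
  simp only [Nat.add_sub_cancel] at h ⊢
  linear_combination h

lemma mul_sum_walshInd_dual_zero (hp2 : p ≠ 2) (hn : 0 < n) (hq : Fintype.card F = p ^ n)
    (hA : A ^ 2 = 1) (h0 : f 0 = 0)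
    (hT : ∀ β j, shiftCount p f β j = p ^ (n - 1) +
      A * p ^ N * (walshInd p f β * quadraticChar (ZMod p) (j - g β))) :
    (p : ℤ) * ∑ β, (if g β = 0 then walshInd p f β else 0) = ∑ β, walshInd p f β := by
  have hp := (Fact.out : p.Prime)
  have hp0 : (p : ℤ) ≠ 0 := by exact_mod_cast hp.ne_zero
  have hA0 : A ≠ 0 := by rintro rfl; simp at hA
  have h : ∑ j, quadraticChar (ZMod p) j *
      (A * p ^ N * ∑ β, walshInd p f β * quadraticChar (ZMod p) (j - g β)) = 0 := by
    have hj : ∀ j : ZMod p, quadraticChar (ZMod p) j *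
        ((if j = 0 then (p : ℤ) ^ n else 0) - p ^ (n - 1)) =
        -p ^ (n - 1) * quadraticChar (ZMod p) j := by
      intro j
      by_cases hj : j = 0
      · simp [hj]
      · simp [hj]; ring
    rw [Finset.sum_congr rfl fun j _ => by
      rw [sum_walshInd_mul_quadraticChar hn hq h0 hT, hj], ← Finset.mul_sum,
      quadraticChar_sum_zero (ringChar_zmod_ne_two p hp2), mul_zero]
  have h2 : ∑ j, quadraticChar (ZMod p) j *
      (A * p ^ N * ∑ β, walshInd p f β * quadraticChar (ZMod p) (j - g β)) =
      A * p ^ N * ∑ β, (p * (if g β = 0 then walshInd p f β else 0) - walshInd p f β) := by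
    simp only [Finset.mul_sum]
    rw [Finset.sum_comm]
    refine Finset.sum_congr rfl fun β _ => ?_
    have := sum_quadraticChar_mul_sub p hp2 (g β)
    rw [Finset.sum_congr rfl (g := fun j => (A * p ^ N * walshInd p f β) *
      (quadraticChar (ZMod p) j * quadraticChar (ZMod p) (j - g β))) fun j _ => by ring,
      ← Finset.mul_sum, this]
    split_ifs <;> ring
  rw [h2, Finset.sum_sub_distrib, ← Finset.mul_sum, mul_eq_zero] at h
  exact sub_eq_zero.1 (h.resolve_left (mul_ne_zero hA0 (pow_ne_zero _ hp0)))

end DualSums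

section MinimalCode

variable (p : ℕ) [Fact p.Prime] {F : Type*} [Field F] [Fintype F] [Algebra (ZMod p) F]

lemma wtOn_eq_sum (D : Finset F) (β : F) : (wtOn p D β : ℤ) =
    ∑ d ∈ D, if Algebra.trace (ZMod p) F (β * d) ≠ 0 then 1 else 0 := by
  rw [Finset.sum_boole, wtOn]

lemma wtOn_eq_zero_iff (D : Finset F) (β : F) : wtOn p D β = 0 ↔ cword p D β = 0 := by
  simp [wtOn, cword, Finset.filter_eq_empty_iff, funext_iff]

lemma cword_injective_of_wtOn_pos {D : Finset F} (h : ∀ β, β ≠ 0 → 0 < wtOn p D β) :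
    Function.Injective (cword p D) := by
  intro β β' hβ
  by_contra hne
  have h1 := h _ (sub_ne_zero.2 hne)
  refine h1.ne' ((wtOn_eq_zero_iff p D _).2 ?_)
  funext d
  have := congrFun hβ d
  simp only [cword] at this
  simp [cword, sub_mul, this]

lemma sum_ne_zero_of_imp {u v : ZMod p} (h : v ≠ 0 → u ≠ 0) :
    ∑ a ∈ Finset.univ.erase (0 : ZMod p), (if u - a * v ≠ 0 then (1 : ℤ) else 0) =
      ((p : ℤ) - 1) * (if u ≠ 0 then 1 else 0) - if v ≠ 0 then 1 else 0 := by
  have hcard : ((Finset.univ.erase (0 : ZMod p)).card : ℤ) = p - 1 := by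
    rw [Finset.card_erase_of_mem (Finset.mem_univ _), Finset.card_univ, ZMod.card,
      Nat.cast_sub (Fact.out : p.Prime).one_le, Nat.cast_one]
  by_cases hv : v = 0
  · by_cases hu : u = 0
    · simp [hu, hv]
    · simp [hu, hv, hcard, -Finset.card_erase_of_mem]
  · have hu := h hv
    have ha : ∀ a, (if u - a * v ≠ 0 then (1 : ℤ) else 0) = 1 - if a = u / v then 1 else 0 := by
      intro a
      have : u - a * v = 0 ↔ a = u / v := by rw [eq_div_iff hv, sub_eq_zero, eq_comm]
      simp only [ne_eq, this]
      split_ifs <;> simp_all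
    rw [Finset.sum_congr rfl fun a _ => ha a, Finset.sum_sub_distrib, Finset.sum_const,
      nsmul_eq_mul, hcard]
    simp [hu, hv]

/-- If `c_β` covers `c_β'`, the weights of the words `c_β - a c_β'` have a known sum. -/
lemma sum_wtOn_of_covers {D : Finset F} {β β' : F} (h : Covers (cword p D β) (cword p D β')) :
    ∑ a ∈ Finset.univ.erase (0 : ZMod p), (wtOn p D (β - algebraMap (ZMod p) F a * β') : ℤ) =
      ((p : ℤ) - 1) * wtOn p D β - wtOn p D β' := by
  simp only [wtOn_eq_sum]
  rw [Finset.sum_comm, Finset.mul_sum, ← Finset.sum_sub_distrib]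
  refine Finset.sum_congr rfl fun d hd => ?_
  refine Eq.trans ?_ (sum_ne_zero_of_imp p (h ⟨d, hd⟩))
  refine Finset.sum_congr rfl fun a _ => ?_
  rw [sub_mul, mul_assoc, ← Algebra.smul_def, map_sub, map_smul, smul_eq_mul]

/-- The Ashikhmin–Barg criterion. -/
lemma isMinimalCode_of_wtOn_bounds {D : Finset F} {w W : ℤ}
    (hw : ∀ β, β ≠ 0 → w ≤ wtOn p D β) (hW : ∀ β, β ≠ 0 → (wtOn p D β : ℤ) ≤ W)
    (h : ((p : ℤ) - 1) * W < p * w) : IsMinimalCode p D := by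
  have hp := (Fact.out : p.Prime)
  have hp1 : (1 : ℤ) < p := by exact_mod_cast hp.one_lt
  intro β hβ β' hβ' hcov
  have hne : ∀ {γ : F}, cword p D γ ≠ 0 → γ ≠ 0 := by
    rintro γ hγ rfl
    exact hγ (by funext d; simp [cword])
  by_cases hex : ∃ a : ZMod p, a ≠ 0 ∧ β = algebraMap (ZMod p) F a * β'
  · obtain ⟨a, ha, rfl⟩ := hex
    refine ⟨a⁻¹, inv_ne_zero ha, ?_⟩
    funext d
    simp only [cword, Pi.smul_apply, smul_eq_mul]
    rw [mul_assoc, ← Algebra.smul_def, map_smul, smul_eq_mul, inv_mul_cancel_left₀ ha]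
  · push Not at hex
    exfalso
    have hsum := sum_wtOn_of_covers p hcov
    have hlow := Finset.card_nsmul_le_sum (Finset.univ.erase (0 : ZMod p))
      (fun a => (wtOn p D (β - algebraMap (ZMod p) F a * β') : ℤ)) w (fun a ha =>
        hw _ (sub_ne_zero.2 (hex a (Finset.ne_of_mem_erase ha))))
    rw [hsum, Finset.card_erase_of_mem (Finset.mem_univ _), Finset.card_univ, ZMod.card,
      nsmul_eq_mul, Nat.cast_sub hp.one_le, Nat.cast_one] at hlow
    have h1 := hw β' (hne hβ')
    have h2 := mul_le_mul_of_nonneg_left (hW β (hne hβ)) (by omega : (0 : ℤ) ≤ p - 1)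
    linarith

lemma isMinimalCode_and_hasParams {D : Finset F} {m w W : ℤ} (hcard : (D.card : ℤ) = m)
    (hw0 : 0 < w) (hw : ∀ β, β ≠ 0 → w ≤ wtOn p D β) (hW : ∀ β, β ≠ 0 → (wtOn p D β : ℤ) ≤ W)
    (h : ((p : ℤ) - 1) * W < p * w) (hex : ∃ β, β ≠ 0 ∧ (wtOn p D β : ℤ) = w) :
    IsMinimalCode p D ∧ HasParams p D m w := by
  refine ⟨isMinimalCode_of_wtOn_bounds p hw hW h, hcard, cword_injective_of_wtOn_pos p
    fun β hβ => by exact_mod_cast hw0.trans_le (hw β hβ), fun β hβ => hw β ?_, ?_⟩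
  · rintro rfl
    exact hβ (by funext d; simp [cword])
  · obtain ⟨β, -, hβ⟩ := hex
    refine ⟨β, fun h0 => ?_, hβ⟩
    rw [(wtOn_eq_zero_iff p D β).2 h0] at hβ
    simp only [Nat.cast_zero] at hβ
    omega

end MinimalCode

section Support

variable {p : ℕ} [Fact p.Prime] {F : Type*} [Field F] [Fintype F] [Algebra (ZMod p) F]
  {n N l : ℕ} {f g : F → ZMod p} {A : ℤ}

lemma walshInd_eq_zero_or_one (f : F → ZMod p) (β : F) :
    walshInd p f β = 0 ∨ walshInd p f β = 1 := by
  rw [walshInd]; split_ifs <;> simp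

lemma sum_walshInd_eq (hp2 : p ≠ 2) (hq : Fintype.card F = p ^ n) (hA : A ^ 2 = 1)
    (hl : n = N + l + 1)
    (hT : ∀ β j, shiftCount p f β j = p ^ (n - 1) +
      A * p ^ N * (walshInd p f β * quadraticChar (ZMod p) (j - g β))) :
    ∑ β, walshInd p f β = p * (p : ℤ) ^ (2 * l) := by
  have hp0 : (p : ℤ) ≠ 0 := by exact_mod_cast (Fact.out : p.Prime).ne_zero
  have h := sum_walshInd hp2 (by omega) hq hA hT
  apply mul_left_cancel₀ (pow_ne_zero (2 * N) hp0)
  rw [h, show 2 * (n - 1) = 2 * N + 2 * l by omega, pow_add]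
  ring

lemma sum_walshInd_dual_zero (hp2 : p ≠ 2) (hq : Fintype.card F = p ^ n) (hA : A ^ 2 = 1)
    (hl : n = N + l + 1) (h0 : f 0 = 0)
    (hT : ∀ β j, shiftCount p f β j = p ^ (n - 1) +
      A * p ^ N * (walshInd p f β * quadraticChar (ZMod p) (j - g β))) :
    ∑ β, (if g β = 0 then walshInd p f β else 0) = (p : ℤ) ^ (2 * l) := by
  have hp0 : (p : ℤ) ≠ 0 := by exact_mod_cast (Fact.out : p.Prime).ne_zero
  apply mul_left_cancel₀ hp0
  rw [mul_sum_walshInd_dual_zero hp2 (by omega) hq hA h0 hT, sum_walshInd_eq hp2 hq hA hl hT]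

lemma sum_walshInd_mul_quadraticChar_neg (hq : Fintype.card F = p ^ n)
    (hl : n = N + l + 1) (h0 : f 0 = 0)
    (hT : ∀ β j, shiftCount p f β j = p ^ (n - 1) +
      A * p ^ N * (walshInd p f β * quadraticChar (ZMod p) (j - g β))) :
    A * ∑ β, walshInd p f β * quadraticChar (ZMod p) (-g β) = ((p : ℤ) - 1) * p ^ l := by
  have hp0 : (p : ℤ) ≠ 0 := by exact_mod_cast (Fact.out : p.Prime).ne_zero
  have h := sum_walshInd_mul_quadraticChar (by omega) hq h0 hT 0
  simp only [zero_sub, if_true] at h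
  apply mul_left_cancel₀ (pow_ne_zero N hp0)
  rw [show n - 1 = N + l by omega, hl] at h
  linear_combination h

lemma exists_dual_eq_zero (hp2 : p ≠ 2) (hq : Fintype.card F = p ^ n) (hA : A ^ 2 = 1)
    (hl : n = N + l + 1) (hl0 : l ≠ 0) (h0 : f 0 = 0)
    (hT : ∀ β j, shiftCount p f β j = p ^ (n - 1) +
      A * p ^ N * (walshInd p f β * quadraticChar (ZMod p) (j - g β))) :
    ∃ β, β ≠ 0 ∧ walshInd p f β = 1 ∧ g β = 0 := by
  by_contra! hno
  have hp1 : (1 : ℤ) < p := by exact_mod_cast (Fact.out : p.Prime).one_lt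
  have h := sum_walshInd_dual_zero hp2 hq hA hl h0 hT
  rw [Finset.sum_eq_single_of_mem 0 (Finset.mem_univ _) fun β _ hβ => by
    rcases walshInd_eq_zero_or_one f β with h1 | h1
    · simp [h1]
    · simp [hno β hβ h1]] at h
  have h1 : (1 : ℤ) < p ^ (2 * l) := one_lt_pow₀ hp1 (by omega)
  rcases walshInd_eq_zero_or_one f 0 with h2 | h2 <;> rw [h2] at h <;> split_ifs at h <;> omega

lemma exists_quadraticChar_neg_dual_eq_one (hp2 : p ≠ 2) (hq : Fintype.card F = p ^ n)
    (hA : A = -1) (hl : n = N + l + 1) (hl0 : l ≠ 0) (h0 : f 0 = 0)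
    (hT : ∀ β j, shiftCount p f β j = p ^ (n - 1) +
      A * p ^ N * (walshInd p f β * quadraticChar (ZMod p) (j - g β))) :
    ∃ β, walshInd p f β = 1 ∧ quadraticChar (ZMod p) (-g β) = 1 := by
  by_contra! hno
  have hp1 : (1 : ℤ) < p := by exact_mod_cast (Fact.out : p.Prime).one_lt
  have hA2 : A ^ 2 = 1 := by rw [hA]; norm_num
  have hG := sum_walshInd_dual_zero hp2 hq hA2 hl h0 hT
  have hW := sum_walshInd_eq hp2 hq hA2 hl hT
  have hS := sum_walshInd_mul_quadraticChar_neg hq hl h0 hT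
  have hβ : ∀ β, walshInd p f β * quadraticChar (ZMod p) (-g β) =
      (if g β = 0 then walshInd p f β else 0) - walshInd p f β := by
    intro β
    rcases walshInd_eq_zero_or_one f β with h1 | h1
    · simp [h1]
    · by_cases h2 : g β = 0
      · simp [h2]
      · rw [(quadraticChar_dichotomy (neg_ne_zero.2 h2)).resolve_left (hno β h1)]
        simp [h1, h2]
  rw [Finset.sum_congr rfl fun β _ => hβ β, Finset.sum_sub_distrib, hG, hW, hA] at hS
  have h1 : (1 : ℤ) < p ^ l := one_lt_pow₀ hp1 hl0
  have h2 : ((p : ℤ) - 1) * p ^ l * (p ^ l - 1) = 0 := by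
    rw [pow_mul'] at hS
    linear_combination hS
  have h3 : 0 < ((p : ℤ) - 1) * p ^ l * (p ^ l - 1) :=
    mul_pos (mul_pos (by omega) (by omega)) (by omega)
  omega

end Support

/-- The bound needed for the Ashikhmin–Barg criterion. -/
lemma succ_mul_pow_lt {m N l n : ℕ} (hp : p = 2 * m + 1) (hm : 0 < m) (hN : 0 < N) (hl2 : 2 ≤ l)
    (hl : n = N + l + 1) :
    (2 * (m : ℤ) + 1) * (m + 1) * p ^ (N - 1) < m * p ^ (n - 2) := by
  have hp1 : (1 : ℤ) ≤ p := by omega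
  have h1 : (p : ℤ) ^ 2 * p ^ (N - 1) ≤ p ^ (n - 2) := by
    rw [← pow_add]
    exact pow_le_pow_right₀ hp1 (by omega)
  have h2 : (0 : ℤ) < p ^ (N - 1) := by positivity
  have h3 : (p : ℤ) = 2 * m + 1 := by exact_mod_cast hp
  have hm' : (1 : ℤ) ≤ m := by exact_mod_cast hm
  refine lt_of_lt_of_le ?_ (mul_le_mul_of_nonneg_left h1 (by omega : (0 : ℤ) ≤ m))
  rw [← mul_assoc]
  refine mul_lt_mul_of_pos_right ?_ h2
  rw [h3]
  nlinarith

section Weights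

variable {p : ℕ} [Fact p.Prime] {F : Type*} [Field F] [Fintype F] [Algebra (ZMod p) F]

lemma two_mul_wtOn_eq {n N : ℕ} {f g : F → ZMod p} {A : ℤ} {β : F}
    (hw : 2 * (wtOn p (Dsq p f) β : ℤ) = ((p : ℤ) - 1) * (((p : ℤ) - 1) * p ^ (n - 2) +
      A * p ^ (N - 1) * ((p : ℤ) - 1 - walshInd p f β *
        if g β = 0 then (p : ℤ) - 1 else -1 - quadraticChar (ZMod p) (-g β)))) :
    ∃ Y : ℤ, 0 ≤ Y ∧ Y ≤ p + 1 ∧ 2 * (wtOn p (Dsq p f) β : ℤ) =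
      ((p : ℤ) - 1) * (((p : ℤ) - 1) * p ^ (n - 2) + A * p ^ (N - 1) * Y) := by
  refine ⟨_, ?_, ?_, hw⟩ <;>
  · have hp1 : (1 : ℤ) ≤ p := by exact_mod_cast (Fact.out : p.Prime).one_le
    rcases walshInd_eq_zero_or_one f β with h1 | h1 <;> rw [h1]
    · omega
    · split_ifs with h2
      · omega
      · rcases quadraticChar_dichotomy (neg_ne_zero.2 h2) with h3 | h3 <;> rw [h3] <;> omega

end Weights

theorem statement_18 (p n s : ℕ) [Fact p.Prime] (hp : p ≠ 2) (hn : 0 < n) (hs : s ≤ n)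
    {F : Type*} [Field F] [Fintype F] [Algebra (ZMod p) F]
    (hq : Fintype.card F = p ^ n)
    (f g : F → ZMod p) (ε : ℂ)
    (hf : IsWRP p n s f ε g)
    (hodd : Odd (n + s)) (hcond : s + 5 ≤ n) :
    (ε * (eta0 p (-1)) ^ ((n + s - 1) / 2) = 1 →
      IsMinimalCode p (Dsq p f) ∧
      HasParams p (Dsq p f)
        (((p : ℤ) - 1) / 2 * ((p : ℤ) ^ (n - 1) + (p : ℤ) ^ ((n + s - 1) / 2)))
        (((p : ℤ) - 1) ^ 2 / 2 * (p : ℤ) ^ (n - 2))) ∧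
    (ε * (eta0 p (-1)) ^ ((n + s - 1) / 2) ≠ 1 →
      IsMinimalCode p (Dsq p f) ∧
      HasParams p (Dsq p f)
        (((p : ℤ) - 1) / 2 * ((p : ℤ) ^ (n - 1) - (p : ℤ) ^ ((n + s - 1) / 2)))
        (((p : ℤ) - 1) / 2 * (((p : ℤ) - 1) * (p : ℤ) ^ (n - 2)
            - ((p : ℤ) + 1) * (p : ℤ) ^ ((n + s - 3) / 2)))) := by
  obtain ⟨hpl, hw0, hf0, h, hh, heven, hgcd, hom⟩ := hf
  obtain ⟨N, hN⟩ := hodd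
  obtain ⟨l, hl⟩ : ∃ l, n = N + l + 1 := ⟨n - N - 1, by omega⟩
  have hN0 : 0 < N := by omega
  have hl2 : 2 ≤ l := by omega
  obtain ⟨m, hpm⟩ := (Fact.out : p.Prime).odd_of_ne_two hp
  have hm : 0 < m := by have := (Fact.out : p.Prime).two_le; omega
  have hpm' : (p : ℤ) = 2 * m + 1 := by exact_mod_cast hpm
  have hm' : (0 : ℤ) < m := by exact_mod_cast hm
  obtain ⟨A, hA, hAε, hT⟩ := shiftCount_eq_of_plateaued p hp hn hq hpl hN
  have hg0 : g 0 = 0 := dual_zero_eq_zero p hp hf0 (fun x => by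
    simpa [heven.neg_one_pow] using hom (-1) x) hT
  have hcard : 2 * ((Dsq p f).card : ℤ) = ((p : ℤ) - 1) * (p ^ (n - 1) + A * p ^ N) := by
    have h0 : squareCount p f 0 = (Dsq p f).card := by simp [squareCount, Dsq]
    have := two_mul_squareCount p hp hT 0
    rw [h0, hg0, walshInd, if_neg hw0, if_pos rfl] at this
    linear_combination this
  have hwt := fun β (hβ : β ≠ 0) =>
    two_mul_wtOn p hp (by omega) hN0 hq hh heven hgcd hom hT hcard hβ
  have hbound := succ_mul_pow_lt hpm hm hN0 hl2 hl
  have hM : (0 : ℤ) < p ^ (N - 1) := pow_pos (by omega) _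
  have hdiv : ((p : ℤ) - 1) / 2 = m := by omega
  have hdiv2 : ((p : ℤ) - 1) ^ 2 / 2 = 2 * m ^ 2 := by
    rw [show ((p : ℤ) - 1) ^ 2 = 2 * (2 * m ^ 2) by rw [hpm']; ring,
      Int.mul_ediv_cancel_left _ two_ne_zero]
  rw [show (n + s - 1) / 2 = N by omega, show (n + s - 3) / 2 = N - 1 by omega, ← hAε, hdiv, hdiv2]
  have hrange := fun β (hβ : β ≠ 0) => two_mul_wtOn_eq (hwt β hβ)
  generalize (p : ℤ) ^ (N - 1) = M at *
  generalize (p : ℤ) ^ (n - 2) = P at *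
  have hD : ((Dsq p f).card : ℤ) = m * (p ^ (n - 1) + A * p ^ N) := by
    rw [hpm'] at hcard ⊢
    linarith
  have hmM : 0 < m * M := mul_pos hm' hM
  refine ⟨fun hcase => ?_, fun hcase => ?_⟩
  · have hA1 : A = 1 := by exact_mod_cast hcase
    subst hA1
    obtain ⟨β₀, hβ₀, h1, h2⟩ := exists_dual_eq_zero hp hq (by norm_num) hl (by omega) hf0 hT
    refine isMinimalCode_and_hasParams p (W := m * (2 * m * P + (2 * m + 2) * M))
      (by rw [hD, one_mul]) ?_ (fun β hβ => ?_) (fun β hβ => ?_) ?_ ⟨β₀, hβ₀, ?_⟩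
    · have : 0 < P := by nlinarith
      positivity
    · obtain ⟨Y, hY0, -, hY⟩ := hrange β hβ
      rw [hpm'] at hY
      have := mul_nonneg hmM.le hY0
      linarith
    · obtain ⟨Y, -, hY1, hY⟩ := hrange β hβ
      rw [hpm'] at hY hY1
      have := mul_le_mul_of_nonneg_left hY1 hmM.le
      linarith
    · rw [hpm']
      nlinarith
    · have := hwt β₀ hβ₀
      rw [h1, if_pos h2, hpm'] at this
      linarith
  · have hA1 : A = -1 := hA.resolve_left fun h1 => hcase (by rw [h1, Int.cast_one])
    obtain ⟨β₀, h1, h2⟩ :=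
      exists_quadraticChar_neg_dual_eq_one hp hq hA1 hl (by omega) hf0 hT
    have hg1 : g β₀ ≠ 0 := fun h3 => by simp [h3] at h2
    have hβ₀ : β₀ ≠ 0 := fun h3 => hg1 (h3 ▸ hg0)
    subst hA1
    refine isMinimalCode_and_hasParams p (W := 2 * m ^ 2 * P)
      (by rw [hD, neg_one_mul, sub_eq_add_neg]) ?_ (fun β hβ => ?_) (fun β hβ => ?_) ?_
      ⟨β₀, hβ₀, ?_⟩
    · rw [hpm']
      refine mul_pos hm' ?_
      nlinarith
    · obtain ⟨Y, -, hY1, hY⟩ := hrange β hβ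
      rw [hpm'] at hY hY1 ⊢
      have := mul_le_mul_of_nonneg_left hY1 hmM.le
      linarith
    · obtain ⟨Y, hY0, -, hY⟩ := hrange β hβ
      rw [hpm'] at hY
      have := mul_nonneg hmM.le hY0
      linarith
    · rw [hpm']
      nlinarith
    · have := hwt β₀ hβ₀
      rw [h1, if_neg hg1, h2, hpm'] at this
      rw [hpm']
      linarith
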